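/- Let k, ℓ be positive integers and let λ = (k^ℓ) be the rectangular partition with ℓ parts equal to k. Then for any number of variables n ≥ ℓ, the symmetric polynomial (s_λ^{(1)})^2 − s_λ · s_λ^{(2)} in the variables x_1,…,x_n is Schur positive. -/

import Mathlib

open MvPolynomial

noncomputable section

/-- The complete homogeneous symmetric polynomial in `n` variables, indexed by an
integer (by convention it is `0` for negative indices). -/
def hInt (n : ℕ) (k : ℤ) : MvPolynomial (Fin n) ℚ :=
  if 0 ≤ k then MvPolynomial.hsymm (Fin n) ℚ k.toNat else 0

/-- The number of (nonzero) parts of a partition `lam : ℕ → ℕ` (parts are indexed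
starting from `0`). -/
def partLen (lam : ℕ → ℕ) : ℕ := sInf {N | lam N = 0}

/-- A partition, recorded as a weakly decreasing, eventually zero function `ℕ → ℕ`
listing its parts (indexed starting from `0`). -/
def IsPartition (lam : ℕ → ℕ) : Prop := Antitone lam ∧ ∃ N, ∀ i, N ≤ i → lam i = 0

/-- The Schur polynomial of a partition in `n` variables, via the Jacobi-Trudi identity
`s_lam = det (h_{lam_i + j - i})`. -/
def schur (n : ℕ) (lam : ℕ → ℕ) : MvPolynomial (Fin n) ℚ :=
  (Matrix.of fun i j : Fin (partLen lam) =>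
    hInt n ((lam i : ℤ) + ((j : ℕ) : ℤ) - ((i : ℕ) : ℤ))).det

/-- The `i`-th derived polynomial `p^{(i)}` of `p`, defined by the identity
`p (x₁ + t, …, xₙ + t) = ∑ i, t^i • p^{(i)} (x₁, …, xₙ)`: substituting `X j + t` for each
variable `X j` yields a polynomial in `t` whose `t^i`-coefficient is `p^{(i)}`. -/
def derived (n i : ℕ) (p : MvPolynomial (Fin n) ℚ) : MvPolynomial (Fin n) ℚ :=
  (MvPolynomial.aeval
    (fun j : Fin n => (Polynomial.C (X j) + Polynomial.X : Polynomial (MvPolynomial (Fin n) ℚ)))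
    p).coeff i

/-- A symmetric polynomial is Schur positive if it is a linear combination of Schur
polynomials (of partitions) with non-negative coefficients. -/
def SchurPositive (n : ℕ) (f : MvPolynomial (Fin n) ℚ) : Prop :=
  ∃ (S : Finset (ℕ → ℕ)) (c : (ℕ → ℕ) → ℚ),
    (∀ μ ∈ S, IsPartition μ) ∧ (∀ μ ∈ S, 0 ≤ c μ) ∧ f = ∑ μ ∈ S, c μ • schur n μ


section

open Finset Matrix

/-- The determinant `det (h_{b i + v j})`, with rows recorded by integers `b` and columns by
naturals `v`. -/
def rowDet {ι R : Type*} [Fintype ι] [DecidableEq ι] [CommRing R] (h : ℤ → R) (v : ι → ℕ)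
    (b : ι → ℤ) : R :=
  (Matrix.of fun i j => h (b i + v j)).det

section rowDet

variable {ι R : Type*} [Fintype ι] [DecidableEq ι] [CommRing R] (h : ℤ → R) (v : ι → ℕ)

lemma rowDet_eq_zero_of_eq {b : ι → ℤ} {i j : ι} (hij : i ≠ j) (hb : b i = b j) :
    rowDet h v b = 0 :=
  Matrix.det_zero_of_row_eq hij (by ext x; simp [hb])

lemma rowDet_eq_zero_of_neg (hh : ∀ m < 0, h m = 0) {b : ι → ℤ} {i : ι}
    (hb : ∀ j, b i + v j < 0) : rowDet h v b = 0 :=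
  Matrix.det_eq_zero_of_row_eq_zero i fun j => by simp [hh _ (hb j)]

lemma rowDet_comp_perm (b : ι → ℤ) (σ : Equiv.Perm ι) :
    rowDet h v (b ∘ σ) = (Equiv.Perm.sign σ : ℤ) • rowDet h v b := by
  have := Matrix.det_permute σ (Matrix.of fun i j => h (b i + v j))
  rw [rowDet, rowDet, zsmul_eq_mul, ← this]
  rfl

lemma rowDet_swap (b : ι → ℤ) {i j : ι} (hij : i ≠ j) :
    rowDet h v (b ∘ Equiv.swap i j) = -rowDet h v b := by
  rw [rowDet_comp_perm, Equiv.Perm.sign_swap hij]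
  simp

/-- Lowering the rows one at a time and summing annihilates a determinant with two equal rows. -/
lemma sum_rowDet_sub_single {b : ι → ℤ} {i j : ι} (hij : i ≠ j) (hb : b i = b j) :
    ∑ x, rowDet h v (b - Pi.single x 1) = 0 := by
  rw [← Finset.sum_subset (Finset.subset_univ {i, j})]
  · rw [Finset.sum_pair hij]
    have : b - Pi.single j 1 = (b - Pi.single i 1) ∘ Equiv.swap i j := by
      ext x
      rcases eq_or_ne x i with rfl | hx
      · simp [hij, hij.symm, hb]
      rcases eq_or_ne x j with rfl | hx'
      · simp [hb]
      · simp [Equiv.swap_apply_of_ne_of_ne hx hx', hx, hx']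
    rw [this, rowDet_swap h v _ hij, add_neg_cancel]
  · intro x _ hx
    simp only [Finset.mem_insert, Finset.mem_singleton, not_or] at hx
    exact rowDet_eq_zero_of_eq h v hij (by simp [Ne.symm hx.1, Ne.symm hx.2, hb])

end rowDet

lemma hInt_of_neg (n : ℕ) {m : ℤ} (hm : m < 0) : hInt n m = 0 := by
  simp [hInt, hm.not_ge]

lemma coeff_hsymm (n m : ℕ) (a : Fin n →₀ ℕ) :
    coeff a (hsymm (Fin n) ℚ m) = if a.degree = m then 1 else 0 := by
  have key : ∀ s : Multiset (Fin n),
      (s.map (X : Fin n → MvPolynomial (Fin n) ℚ)).prod = monomial (Multiset.toFinsupp s) 1 := by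
    intro s
    induction s using Multiset.induction_on with
    | empty => simp
    | cons x s ih =>
      rw [Multiset.map_cons, Multiset.prod_cons, ih, X, monomial_mul, ← Multiset.singleton_add,
        map_add, Multiset.toFinsupp_singleton, one_mul]
  have hcard : (Finsupp.toMultiset a).card = a.degree := by
    rw [Finsupp.card_toMultiset, Finsupp.degree]
    rfl
  simp only [hsymm, coeff_sum, key, coeff_monomial]
  split_ifs with h
  · refine (Finset.sum_eq_single (⟨Finsupp.toMultiset a, hcard.trans h⟩ : Sym (Fin n) m)
      ?_ ?_).trans ?_
    · intro s _ hs
      rw [if_neg]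
      rintro rfl
      exact hs (Subtype.ext (by simp))
    · exact fun h => absurd (Finset.mem_univ (α := Sym (Fin n) m) _) h
    · exact if_pos (by simp)
  · refine Finset.sum_eq_zero fun s _ => if_neg ?_
    rintro rfl
    apply h
    rw [← hcard, Multiset.toFinsupp_toMultiset]
    exact s.2

/-- The derivation `∑ ∂/∂xᵢ`. -/
def sumPderiv (n : ℕ) : Derivation ℚ (MvPolynomial (Fin n) ℚ) (MvPolynomial (Fin n) ℚ) :=
  mkDerivation ℚ fun _ => 1

lemma sumPderiv_apply (n : ℕ) (p : MvPolynomial (Fin n) ℚ) :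
    sumPderiv n p = ∑ i, pderiv i p := by
  induction p using MvPolynomial.induction_on with
  | C a => simp [sumPderiv]
  | add p q hp hq => simp only [map_add, hp, hq, Finset.sum_add_distrib]
  | mul_X p i hp =>
    simp only [Derivation.leibniz, hp, smul_eq_mul, Finset.sum_add_distrib, ← Finset.mul_sum]
    simp [sumPderiv, mkDerivation_X, pderiv_X, Pi.single_apply]

lemma sumPderiv_hInt (n : ℕ) (m : ℤ) :
    sumPderiv n (hInt n m) = ((n : ℚ) + m - 1) • hInt n (m - 1) := by
  rcases lt_trichotomy m 0 with hm | rfl | hm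
  · simp [hInt_of_neg n hm, hInt_of_neg n (show m - 1 < 0 by omega)]
  · simp [hInt, sumPderiv]
  · obtain ⟨m, rfl⟩ : ∃ r : ℕ, m = r + 1 := ⟨(m - 1).toNat, by omega⟩
    have e : hInt n (m + 1) = hsymm (Fin n) ℚ (m + 1) := by
      rw [hInt, if_pos (by omega)]
      congr 1
    have e' : hInt n (m + 1 - 1) = hsymm (Fin n) ℚ m := by
      rw [hInt, if_pos (by omega)]
      congr 1
      omega
    rw [e, e', sumPderiv_apply]
    ext a
    simp only [coeff_sum, coeff_pderiv, coeff_hsymm, coeff_smul, map_add, Finsupp.degree_single,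
      Nat.add_right_cancel_iff]
    by_cases h : a.degree = m
    · have : ∑ i, (a i : ℚ) = m := by
        rw [← h, Finsupp.degree_eq_sum]
        push_cast
        rfl
      simp [Finset.sum_add_distrib, this, h]
      ring
    · simp [h]

lemma Derivation.map_finset_prod {A ι : Type*} [CommRing A] [Algebra ℚ A] (D : Derivation ℚ A A)
    [DecidableEq ι] (s : Finset ι) (f : ι → A) :
    D (∏ i ∈ s, f i) = ∑ i ∈ s, D (f i) * ∏ j ∈ s.erase i, f j := by
  induction s using Finset.induction_on with
  | empty => simp
  | insert a s ha ih =>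
    rw [Finset.prod_insert ha, Finset.sum_insert ha, Finset.erase_insert ha, D.leibniz, ih,
      smul_eq_mul, smul_eq_mul, add_comm, mul_comm, Finset.mul_sum]
    congr 1
    refine Finset.sum_congr rfl fun i hi => ?_
    rw [Finset.erase_insert_of_ne (by rintro rfl; exact ha hi),
      Finset.prod_insert (fun h => ha (Finset.mem_of_mem_erase h))]
    ring

lemma det_eq_sum_prod_row {A ι : Type*} [CommRing A] [Fintype ι] [DecidableEq ι]
    (M : Matrix ι ι A) :
    M.det = ∑ σ : Equiv.Perm ι, (Equiv.Perm.sign σ : ℤ) • ∏ i, M i (σ i) := by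
  rw [← det_transpose, det_apply]
  rfl

/-- Jacobi formula for a derivation. -/
lemma Derivation.map_det {A : Type*} [CommRing A] [Algebra ℚ A] (D : Derivation ℚ A A)
    {ι : Type*} [Fintype ι] [DecidableEq ι] (M : Matrix ι ι A) :
    D M.det = ∑ i, (M.updateRow i fun j => D (M i j)).det := by
  simp only [det_eq_sum_prod_row, map_sum, map_zsmul, D.map_finset_prod]
  rw [Finset.sum_comm]
  refine Finset.sum_congr rfl fun σ _ => ?_
  rw [← Finset.smul_sum]
  congr 1
  refine Finset.sum_congr rfl fun i _ => ?_
  rw [← Finset.mul_prod_erase _ _ (Finset.mem_univ i), updateRow_self]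
  congr 1
  refine Finset.prod_congr rfl fun j hj => ?_
  rw [updateRow_ne (Finset.ne_of_mem_erase hj)]

lemma sum_det_updateRow_mul {A : Type*} [CommRing A]
    {ι : Type*} [Fintype ι] [DecidableEq ι] (M K : Matrix ι ι A) :
    ∑ i, (M.updateRow i ((M * K) i)).det = K.trace * M.det := by
  have h : ∀ i, (M.updateRow i ((M * K) i)).det = (M * K * M.adjugate) i i := by
    intro i
    rw [← cramer_transpose_apply, cramer_eq_adjugate_mulVec, ← adjugate_transpose, mul_apply,
      mulVec, dotProduct]
    exact Finset.sum_congr rfl fun j _ => mul_comm _ _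
  simp only [h]
  change (M * K * M.adjugate).trace = _
  rw [trace_mul_comm, ← Matrix.mul_assoc, adjugate_mul, smul_mul, trace_smul, smul_eq_mul,
    Matrix.one_mul, mul_comm]

lemma derived_two (n : ℕ) (p : MvPolynomial (Fin n) ℚ) :
    derived n 0 p = p ∧ derived n 1 p = sumPderiv n p ∧
      derived n 2 p = (1 / 2 : ℚ) • sumPderiv n (sumPderiv n p) := by
  induction p using MvPolynomial.induction_on with
  | C a =>
    have : algebraMap ℚ (Polynomial (MvPolynomial (Fin n) ℚ)) a = Polynomial.C (C a) := rfl
    have h0 : sumPderiv n (C a) = 0 := by simp [sumPderiv]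
    rw [h0]
    simp [derived, this, Polynomial.coeff_C]
  | add p q hp hq =>
    have e : ∀ r, derived n r (p + q) = derived n r p + derived n r q := fun r => by
      simp [derived]
    simp only [e, hp, hq, map_add, smul_add, and_self]
  | mul_X p i hp =>
    obtain ⟨hp0, hp1, hp2⟩ := hp
    have hX : sumPderiv n (X i) = 1 := by simp [sumPderiv]
    have e : ∀ r, derived n r (p * X i) = derived n r p * X i +
        if r = 0 then 0 else derived n (r - 1) p := by
      intro r
      rw [derived, map_mul, aeval_X, mul_add, Polynomial.coeff_add, Polynomial.coeff_mul_C]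
      congr 1
      cases r with
      | zero => simp
      | succ r => simp [derived, Polynomial.coeff_mul_X]
    refine ⟨by simp [e, hp0], ?_, ?_⟩
    · simp [e, hp0, hp1, hX, Derivation.leibniz]
      ring
    · simp only [e, Derivation.leibniz, hX, smul_eq_mul, map_add, hp1, hp2, mul_one]
      norm_num
      simp only [MvPolynomial.smul_eq_C_mul]
      have h2 : (C (1 / 2 : ℚ) : MvPolynomial (Fin n) ℚ) * 2 = 1 := by
        rw [← map_ofNat (C (σ := Fin n) (R := ℚ)) 2, ← C_mul]
        norm_num
      linear_combination (- sumPderiv n p) * h2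

/-- The derivation `∑ ∂/∂xᵢ` lowers the rows of a Jacobi-Trudi determinant one at a time. -/
lemma sumPderiv_rowDet (n : ℕ) {L : ℕ} (b : Fin L → ℤ) :
    sumPderiv n (rowDet (hInt n) Fin.val b) =
      ∑ i, ((n : ℚ) + b i - 1) • rowDet (hInt n) Fin.val (b - Pi.single i 1) := by
  set M : Matrix (Fin L) (Fin L) (MvPolynomial (Fin n) ℚ) :=
    of fun i j : Fin L => hInt n (b i + (j : ℕ)) with hM
  let K : Matrix (Fin L) (Fin L) (MvPolynomial (Fin n) ℚ) :=
    of fun i j => if (i : ℕ) + 1 = j then C ((j : ℕ) : ℚ) else 0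
  have hK : K.trace = 0 := by
    simp [Matrix.trace, K]
  have hMK : ∀ i (j : Fin L), (M * K) i j = ((j : ℕ) : ℚ) • hInt n (b i + (j : ℕ) - 1) := by
    intro i j
    rw [mul_apply]
    by_cases hj : (j : ℕ) = 0
    · rw [hj]
      simp only [Nat.cast_zero, zero_smul]
      exact Finset.sum_eq_zero fun x _ => by simp [K, hj]
    · have hlt : (j : ℕ) - 1 < L := by omega
      rw [Finset.sum_eq_single (⟨(j : ℕ) - 1, hlt⟩ : Fin L)]
      · have e : (j : ℕ) - 1 + 1 = j := by omega
        simp only [K, hM, of_apply, e, if_true]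
        rw [MvPolynomial.smul_eq_C_mul, mul_comm]
        congr 2
        push_cast [Nat.one_le_iff_ne_zero.mpr hj]
        ring
      · intro x _ hx
        have : ¬ ((x : ℕ) + 1 = j) := fun h => hx (Fin.ext (by simp; omega))
        simp [K, this]
      · simp
  have hrow : ∀ i, (fun j => sumPderiv n (M i j)) =
      (C ((n : ℚ) + b i - 1) : MvPolynomial (Fin n) ℚ) •
        (fun j : Fin L => hInt n ((b i - 1) + (j : ℕ))) + (M * K) i := by
    intro i
    ext1 j
    rw [Pi.add_apply, Pi.smul_apply, hMK, hM, of_apply, sumPderiv_hInt,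
      show b i - 1 + ((j : ℕ) : ℤ) = b i + (j : ℕ) - 1 by ring, smul_eq_mul,
      ← MvPolynomial.smul_eq_C_mul, ← add_smul]
    push_cast
    congr 1
    ring
  have hlow : ∀ i, M.updateRow i (fun j : Fin L => hInt n ((b i - 1) + (j : ℕ))) =
      of fun x j : Fin L => hInt n ((b - Pi.single i (1 : ℤ) : Fin L → ℤ) x + (j : ℕ)) := by
    intro i
    ext1 x j
    rcases eq_or_ne x i with rfl | hx
    · simp
    · simp [hx, hM]
  rw [rowDet, ← hM, Derivation.map_det]
  simp only [hrow, det_updateRow_add, Finset.sum_add_distrib, sum_det_updateRow_mul, hK, zero_mul,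
    add_zero]
  refine Finset.sum_congr rfl fun i _ => ?_
  rw [det_updateRow_smul, hlow, MvPolynomial.smul_eq_C_mul, rowDet]

lemma schur_eq_rowDet (n : ℕ) (lam : ℕ → ℕ) {L : ℕ} (h : partLen lam = L) :
    schur n lam = rowDet (hInt n) Fin.val (fun i : Fin L => (lam i : ℤ) - (i : ℕ)) := by
  subst h
  rw [schur, rowDet]
  congr 1
  ext1 i j
  simp only [of_apply]
  congr 1
  ring

lemma partLen_eq {lam : ℕ → ℕ} {L : ℕ} (h0 : lam L = 0) (h : ∀ i < L, lam i ≠ 0) :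
    partLen lam = L := by
  refine le_antisymm (Nat.sInf_le h0) (le_csInf ⟨L, h0⟩ fun N hN => ?_)
  by_contra hlt
  exact h N (by omega) hN

lemma schur_rectangle (n : ℕ) {k : ℕ} (hk : 0 < k) (ℓ : ℕ) :
    schur n (fun i => if i < ℓ then k else 0) =
      rowDet (hInt n) Fin.val (fun i : Fin ℓ => (k : ℤ) - (i : ℕ)) := by
  rw [schur_eq_rowDet n _ (partLen_eq (L := ℓ) (by simp) fun i hi => by simp [hi, hk.ne'])]
  congr 1
  ext i
  simp

lemma derived_rectangle (k ℓ n : ℕ) (hk : 0 < k) (hℓ : 0 < ℓ) (c : ℚ) (hc : c = n + k - ℓ)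
    (b : Fin ℓ → ℤ) (hb : b = fun i : Fin ℓ => (k : ℤ) - (i : ℕ)) :
    (derived n 1 (schur n fun i => if i < ℓ then k else 0)) ^ 2 -
        schur n (fun i => if i < ℓ then k else 0) *
          derived n 2 (schur n fun i => if i < ℓ then k else 0) =
      (c ^ 2) • (∑ i, rowDet (hInt n) Fin.val (b - Pi.single i 1)) ^ 2 -
        (c / 2) • (rowDet (hInt n) Fin.val b *
          (c • (∑ i, ∑ j, rowDet (hInt n) Fin.val (b - Pi.single i 1 - Pi.single j 1)) -
            ∑ i, rowDet (hInt n) Fin.val (b - Pi.single i 1 - Pi.single i 1))) := by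
  rw [(derived_two n _).2.1, (derived_two n _).2.2, schur_rectangle n hk, ← hb]
  have hdup : ∀ i : Fin ℓ, (i : ℕ) ≠ ℓ - 1 → ∃ i' : Fin ℓ, i ≠ i' ∧
      (b - Pi.single i 1 : Fin ℓ → ℤ) i = (b - Pi.single i 1 : Fin ℓ → ℤ) i' := by
    intro i hi
    have hne : i ≠ (⟨i + 1, by omega⟩ : Fin ℓ) := fun h => by
      have := congrArg Fin.val h
      simp at this
    refine ⟨⟨i + 1, by omega⟩, hne, ?_⟩
    simp [hb, hne.symm]
    ring
  have hD : sumPderiv n (rowDet (hInt n) Fin.val b) =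
      c • ∑ i, rowDet (hInt n) Fin.val (b - Pi.single i 1) := by
    rw [sumPderiv_rowDet, Finset.smul_sum]
    refine Finset.sum_congr rfl fun i _ => ?_
    by_cases hi : (i : ℕ) = ℓ - 1
    · congr 1
      rw [hc, hb]
      push_cast
      rw [hi, Nat.cast_sub hℓ]
      push_cast
      ring
    · obtain ⟨i', hne, h⟩ := hdup i hi
      rw [rowDet_eq_zero_of_eq _ _ hne h, smul_zero, smul_zero]
  have hDD : sumPderiv n (∑ i, rowDet (hInt n) Fin.val (b - Pi.single i 1)) =
      c • (∑ i, ∑ j, rowDet (hInt n) Fin.val (b - Pi.single i 1 - Pi.single j 1)) -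
            ∑ i, rowDet (hInt n) Fin.val (b - Pi.single i 1 - Pi.single i 1) := by
    have hz : ∀ j : Fin ℓ, ((ℓ : ℚ) - 1 - (j : ℕ)) •
        ∑ i, rowDet (hInt n) Fin.val (b - Pi.single i 1 - Pi.single j 1) = 0 := by
      intro j
      by_cases hj : (j : ℕ) = ℓ - 1
      · rw [hj, Nat.cast_sub hℓ]
        simp
      · obtain ⟨j', hne, h⟩ := hdup j hj
        have := sum_rowDet_sub_single (hInt n) Fin.val hne h
        simp only [sub_right_comm b (Pi.single _ 1) (Pi.single j 1)]
        rw [this, smul_zero]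
    have hz' : ∑ i, ∑ j : Fin ℓ, ((ℓ : ℚ) - 1 - (j : ℕ)) •
        rowDet (hInt n) Fin.val (b - Pi.single i 1 - Pi.single j 1) = 0 := by
      rw [Finset.sum_comm]
      exact Finset.sum_eq_zero fun j _ => by rw [← Finset.smul_sum, hz]
    have hterm : ∀ i, ∑ j, ((n : ℚ) + (b - Pi.single i 1 : Fin ℓ → ℤ) j - 1) •
          rowDet (hInt n) Fin.val (b - Pi.single i 1 - Pi.single j 1) =
        c • ∑ j, rowDet (hInt n) Fin.val (b - Pi.single i 1 - Pi.single j 1) +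
        ∑ j : Fin ℓ, ((ℓ : ℚ) - 1 - (j : ℕ)) •
          rowDet (hInt n) Fin.val (b - Pi.single i 1 - Pi.single j 1) -
        rowDet (hInt n) Fin.val (b - Pi.single i 1 - Pi.single i 1) := by
      intro i
      have : rowDet (hInt n) Fin.val (b - Pi.single i 1 - Pi.single i 1) =
          ∑ j, (if j = i then (1 : ℚ) else 0) •
            rowDet (hInt n) Fin.val (b - Pi.single i 1 - Pi.single j 1) := by
        simp
      rw [this, Finset.smul_sum, ← Finset.sum_add_distrib, ← Finset.sum_sub_distrib]
      refine Finset.sum_congr rfl fun j _ => ?_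
      rw [← add_smul, ← sub_smul]
      congr 1
      simp only [hb, hc, Pi.sub_apply, Pi.single_apply]
      split_ifs <;> push_cast <;> ring
    rw [map_sum]
    simp only [sumPderiv_rowDet, hterm, Finset.sum_sub_distrib, Finset.sum_add_distrib,
      ← Finset.smul_sum]
    simp only [Finset.smul_sum] at hz' ⊢
    rw [hz', add_zero]
  rw [hD, Derivation.map_smul, hDD, smul_pow, smul_smul, mul_smul_comm]
  congr 2
  ring

namespace SchurPositive

variable {n : ℕ} {f g : MvPolynomial (Fin n) ℚ}

lemma zero : SchurPositive n 0 := ⟨∅, 0, by simp, by simp, by simp⟩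

lemma smul {a : ℚ} (ha : 0 ≤ a) (hf : SchurPositive n f) : SchurPositive n (a • f) := by
  obtain ⟨S, c, hS, hc, rfl⟩ := hf
  exact ⟨S, fun μ => a * c μ, hS, fun μ hμ => mul_nonneg ha (hc μ hμ), by
    simp [Finset.smul_sum, smul_smul]⟩

lemma add (hf : SchurPositive n f) (hg : SchurPositive n g) : SchurPositive n (f + g) := by
  classical
  obtain ⟨S, c, hS, hc, rfl⟩ := hf
  obtain ⟨T, d, hT, hd, rfl⟩ := hg
  refine ⟨S ∪ T, fun μ => (if μ ∈ S then c μ else 0) + if μ ∈ T then d μ else 0, ?_, ?_, ?_⟩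
  · intro μ hμ
    exact (Finset.mem_union.mp hμ).elim (hS μ) (hT μ)
  · intro μ _
    refine add_nonneg ?_ ?_
    · split_ifs with h
      exacts [hc μ h, le_rfl]
    · split_ifs with h
      exacts [hd μ h, le_rfl]
  · simp only [add_smul, Finset.sum_add_distrib, ite_smul, zero_smul, Finset.sum_ite_mem]
    rw [Finset.inter_eq_right.mpr Finset.subset_union_left,
      Finset.inter_eq_right.mpr Finset.subset_union_right]

lemma sum {ι : Type*} {s : Finset ι} {f : ι → MvPolynomial (Fin n) ℚ}
    (h : ∀ i ∈ s, SchurPositive n (f i)) : SchurPositive n (∑ i ∈ s, f i) :=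
  Finset.sum_induction f _ (fun _ _ => add) zero h

lemma schur {lam : ℕ → ℕ} (h : IsPartition lam) : SchurPositive n (schur n lam) :=
  ⟨{lam}, 1, by simpa using h, by simp, by simp⟩

/-- Straightening: a Jacobi-Trudi determinant with weakly decreasing rows is zero or a Schur
polynomial. -/
lemma rowDet {L : ℕ} {b : Fin L → ℤ} (hb : Antitone b) :
    SchurPositive n (rowDet (hInt n) Fin.val b) := by
  induction L with
  | zero =>
    have h : IsPartition fun _ => 0 := ⟨antitone_const, 0, by simp⟩
    have := schur (n := n) h
    rw [schur_eq_rowDet n _ (partLen_eq (L := 0) rfl (by simp))] at this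
    simpa [_root_.rowDet] using this
  | succ L ih =>
    by_cases hinj : Function.Injective b
    swap
    · obtain ⟨i, j, hij, hne⟩ : ∃ i j, b i = b j ∧ i ≠ j := by
        simpa [Function.Injective] using hinj
      rw [rowDet_eq_zero_of_eq _ _ hne hij]
      exact zero
    have hstrict : StrictAnti b := hb.strictAnti_of_injective hinj
    have hν : ∀ i j : Fin (L + 1), i ≤ j → b j + (j : ℕ) ≤ b i + (i : ℕ) := by
      have : Antitone fun i : Fin (L + 1) => b i + (i : ℕ) := by
        rw [Fin.antitone_iff_succ_le]
        intro i
        have := hstrict (Fin.castSucc_lt_succ (i := i))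
        simp only [Fin.val_succ, Fin.val_castSucc]
        push_cast
        omega
      exact fun i j h => this h
    rcases lt_trichotomy (b (Fin.last L) + L) 0 with h | h | h
    · rw [rowDet_eq_zero_of_neg _ _ (fun m => hInt_of_neg n) (i := Fin.last L)]
      · exact zero
      · intro j
        have := j.is_le
        omega
    · have : _root_.rowDet (hInt n) Fin.val b =
          _root_.rowDet (hInt n) Fin.val (b ∘ Fin.castSucc) := by
        rw [_root_.rowDet, det_succ_row _ (Fin.last L), Finset.sum_eq_single (Fin.last L)]
        · rw [of_apply, Fin.val_last, h, ← two_mul, pow_mul, Fin.succAbove_last]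
          simp [hInt, _root_.rowDet]
          rfl
        · intro j _ hj
          have : (j : ℕ) < L := Fin.val_lt_last hj
          rw [of_apply, hInt_of_neg n (by omega)]
          simp
        · simp
      rw [this]
      exact ih (hb.comp_monotone Fin.strictMono_castSucc.monotone)
    · let lam : ℕ → ℕ := fun i => if hi : i < L + 1 then (b ⟨i, hi⟩ + i).toNat else 0
      have hpos : ∀ i : Fin (L + 1), 0 < b i + (i : ℕ) := fun i =>
        h.trans_le (by simpa using hν i (Fin.last L) (Fin.le_last i))
      have hlam : IsPartition lam := by
        refine ⟨fun i j hij => ?_, L + 1, fun i hi => dif_neg (by omega)⟩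
        by_cases hj : j < L + 1
        · have := hν ⟨i, by omega⟩ ⟨j, hj⟩ hij
          simp only [lam, hj, show i < L + 1 by omega, dif_pos]
          exact Int.toNat_le_toNat this
        · rw [show lam j = 0 from dif_neg hj]
          exact Nat.zero_le _
      have := schur (n := n) hlam
      rw [schur_eq_rowDet n _ (partLen_eq (L := L + 1) (by simp [lam]) fun i hi => ?_)] at this
      · convert this using 2
        ext i
        have := hpos i
        simp only [lam, Fin.is_lt, dif_pos]
        rw [Int.toNat_of_nonneg this.le]
        ring
      · have := hpos ⟨i, hi⟩
        simp only [lam, hi, dif_pos]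
        simp only at this
        omega

end SchurPositive

section vandermonde

variable {R : Type*} [CommRing R] {ℓ : ℕ}

lemma prod_sub_mul_eq_sum {ι : Type*} [DecidableEq ι] (s : Finset ι) (f : ι → R) (z y : R) :
    ∏ i ∈ s, (z - f i * y) =
      ∑ r ∈ Finset.range (s.card + 1), (∑ t ∈ s.powersetCard r, ∏ i ∈ t, -f i) *
        (y ^ r * z ^ (s.card - r)) := by
  have : ∀ i, z - f i * y = -f i * y + z := fun i => by ring
  simp only [this]
  rw [Finset.prod_add, Finset.sum_powerset]
  refine Finset.sum_congr rfl fun r _ => ?_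
  rw [Finset.sum_mul]
  refine Finset.sum_congr rfl fun t ht => ?_
  obtain ⟨hts, rfl⟩ := Finset.mem_powersetCard.mp ht
  rw [Finset.prod_mul_distrib, Finset.prod_const, Finset.prod_const,
    Finset.card_sdiff_of_subset hts]
  ring

/-- The Cauchy determinant with denominators cleared. -/
lemma det_prod_erase_one_sub_mul [IsDomain R] {w : Fin ℓ → R} (hw : Function.Injective w)
    (u : Fin ℓ → R) :
    (Matrix.of fun i j => ∏ i' ∈ Finset.univ.erase i, (1 - w i' * u j)).det =
      (vandermonde w).det * (vandermonde u).det := by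
  set c : Matrix (Fin ℓ) (Fin ℓ) R := Matrix.of fun i r =>
    ∑ t ∈ (Finset.univ.erase i).powersetCard (r : ℕ), ∏ i' ∈ t, -w i' with hc
  have key : ∀ i z y, ∏ i' ∈ Finset.univ.erase i, (z - w i' * y) =
      ∑ r : Fin ℓ, c i r * (y ^ (r : ℕ) * z ^ (Fin.rev r : ℕ)) := by
    intro i z y
    have hcard : ((Finset.univ : Finset (Fin ℓ)).erase i).card = ℓ - 1 := by simp
    have hℓ : ℓ - 1 + 1 = ℓ := Nat.sub_add_cancel (Fin.pos i)
    rw [prod_sub_mul_eq_sum, hcard, hℓ, Finset.sum_range]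
    refine Finset.sum_congr rfl fun r _ => ?_
    rw [Fin.val_rev, Nat.sub_sub, add_comm 1]
    rfl
  have h1 : (Matrix.of fun i j => ∏ i' ∈ Finset.univ.erase i, (1 - w i' * u j)) =
      c * (vandermonde u)ᵀ := by
    ext i j
    rw [of_apply, key, mul_apply]
    simp [vandermonde]
  have h2 : c * (projVandermonde 1 w)ᵀ =
      diagonal fun i => ∏ i' ∈ Finset.univ.erase i, (w i - w i') := by
    ext i j
    have := key i (w j) 1
    rw [mul_apply]
    simp only [one_pow, one_mul, mul_one] at this
    simp only [transpose_apply, projVandermonde_apply, Pi.one_apply, one_pow, one_mul, ← this]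
    rcases eq_or_ne i j with rfl | hij
    · simp
    · rw [diagonal_apply_ne _ hij]
      exact Finset.prod_eq_zero (Finset.mem_erase.mpr ⟨hij.symm, Finset.mem_univ _⟩) (sub_self _)
  have h3 : (projVandermonde 1 w).det = ∏ i, ∏ j ∈ Finset.Ioi i, (w i - w j) := by
    simp [det_projVandermonde]
  have h4 : (projVandermonde 1 w).det ≠ 0 := by
    rw [h3]
    refine Finset.prod_ne_zero_iff.mpr fun i _ => Finset.prod_ne_zero_iff.mpr fun j hj => ?_
    exact sub_ne_zero.mpr (hw.ne (Finset.mem_Ioi.mp hj).ne)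
  have h5 : c.det = (vandermonde w).det := by
    refine mul_right_cancel₀ h4 ?_
    have := congrArg Matrix.det h2
    rw [det_mul, det_transpose, det_diagonal] at this
    rw [this, h3, det_vandermonde, ← Finset.prod_mul_distrib]
    simp only [← Finset.prod_mul_distrib]
    have := Finset.prod_prod_Ioi_mul_eq_prod_prod_off_diag fun j i => w i - w j
    simp only [Finset.compl_eq_univ_sdiff, Finset.sdiff_singleton_eq_erase] at this
    rw [← this]
    exact Finset.prod_congr rfl fun i _ => Finset.prod_congr rfl fun j _ => mul_comm _ _
  rw [h1, det_mul, det_transpose, h5]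

lemma det_pow_append (w u : Fin ℓ → R) :
    (Matrix.of fun x y : Fin ℓ ⊕ Fin ℓ => Sum.elim
      (fun i => w i ^ (finSumFinEquiv y : ℕ))
      (fun i => u i ^ (2 * ℓ - 1 - (finSumFinEquiv y : ℕ))) x).det =
    (Equiv.Perm.sign (Fin.revPerm (n := ℓ)) : ℤ) • ((vandermonde w).det * (vandermonde u).det *
      ∏ i, ∏ j, (1 - w i * u j)) := by
  have hrev : (projVandermonde 1 u).det =
      (Equiv.Perm.sign (Fin.revPerm (n := ℓ)) : ℤ) • (vandermonde u).det := by
    rw [zsmul_eq_mul, ← det_permute']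
    congr 1
    ext i j
    simp [projVandermonde_apply, vandermonde]
  have h : (Matrix.of fun x y : Fin ℓ ⊕ Fin ℓ => Sum.elim
      (fun i => w i ^ (finSumFinEquiv y : ℕ))
      (fun i => u i ^ (2 * ℓ - 1 - (finSumFinEquiv y : ℕ))) x) =
      (projVandermonde (Fin.append w 1) (Fin.append 1 u)).submatrix finSumFinEquiv
        finSumFinEquiv := by
    ext x y
    rw [submatrix_apply, projVandermonde_apply, of_apply]
    rcases x with i | i
    · simp
    · have : 2 * ℓ - 1 - (finSumFinEquiv y : ℕ) = ℓ + ℓ - ((finSumFinEquiv y : ℕ) + 1) := by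
        omega
      simp [Fin.val_rev, this, -Fin.natAdd_eq_addNat]
  rw [h, det_submatrix_equiv_self, det_projVandermonde]
  rw [mul_assoc, mul_comm (vandermonde u).det, ← mul_assoc, ← mul_smul_comm, ← hrev,
    det_projVandermonde, det_vandermonde]
  have hI : ∀ {m : ℕ} (F : Fin m → Fin m → R), ∏ i, ∏ j ∈ Finset.Ioi i, F i j =
      ∏ i, ∏ j, if i < j then F i j else 1 := by
    intro m F
    refine Finset.prod_congr rfl fun i _ => ?_
    rw [← Finset.prod_filter]
    congr 1
    ext
    simp
  simp only [hI, Fin.prod_univ_add, Finset.prod_mul_distrib]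
  have h1 : ∀ i j : Fin ℓ, Fin.castAdd ℓ i < Fin.castAdd ℓ j ↔ i < j := fun i j => Iff.rfl
  have h2 : ∀ i j : Fin ℓ, Fin.natAdd ℓ i < Fin.natAdd ℓ j ↔ i < j := fun i j => by
    simp only [Fin.lt_def, Fin.val_natAdd]
    omega
  have h3 : ∀ i j : Fin ℓ, Fin.castAdd ℓ i < Fin.natAdd ℓ j := fun i j => by
    simp only [Fin.lt_def, Fin.val_castAdd, Fin.val_natAdd]
    omega
  have h4 : ∀ i j : Fin ℓ, ¬ Fin.natAdd ℓ i < Fin.castAdd ℓ j := fun i j => (h3 j i).not_gt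
  simp [h1, h2, h3, h4, -Fin.natAdd_eq_addNat]
  ring

end vandermonde

section powEval

variable {R κ : Type*} [CommRing R] [Algebra ℚ R] [Fintype κ] (g : κ → ℕ → R)

/-- The linear functional replacing each power `X x ^ m` by `g x m`. -/
def powEval : MvPolynomial κ ℚ →ₗ[ℚ] R :=
  (basisMonomials κ ℚ).constr ℚ fun a => ∏ x, g x (a x)

lemma powEval_monomial (a : κ →₀ ℕ) : powEval g (monomial a 1) = ∏ x, g x (a x) := by
  have := (basisMonomials κ ℚ).constr_basis ℚ (fun a => ∏ x, g x (a x)) a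
  rwa [coe_basisMonomials] at this

lemma powEval_prod_pow (a : κ → ℕ) : powEval g (∏ x, X x ^ a x) = ∏ x, g x (a x) := by
  have : ∏ x, (X x : MvPolynomial κ ℚ) ^ a x = monomial (Finsupp.equivFunOnFinite.symm a) 1 := by
    rw [monomial_eq, Finsupp.prod_fintype _ _ (by simp)]
    simp
  rw [this, powEval_monomial]
  rfl

lemma powEval_rename {τ : Equiv.Perm κ} (h : ∀ x, g (τ x) = g x) (p : MvPolynomial κ ℚ) :
    powEval g (rename τ p) = powEval g p := by
  suffices (powEval g) ∘ₗ (rename τ).toLinearMap = powEval g from LinearMap.congr_fun this p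
  refine (basisMonomials κ ℚ).ext fun a => ?_
  simp only [coe_basisMonomials, LinearMap.comp_apply, AlgHom.toLinearMap_apply, rename_monomial,
    powEval_monomial]
  rw [← Equiv.prod_comp τ]
  exact Finset.prod_congr rfl fun x _ => by rw [h, Finsupp.mapDomain_apply τ.injective]

lemma powEval_mul_pow_eq_zero {x : κ} {M : ℕ} (h : ∀ m, M ≤ m → g x m = 0)
    (p : MvPolynomial κ ℚ) : powEval g (p * X x ^ M) = 0 := by
  suffices (powEval g) ∘ₗ LinearMap.mulRight ℚ (X x ^ M) = 0 from LinearMap.congr_fun this p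
  refine (basisMonomials κ ℚ).ext fun a => ?_
  simp only [coe_basisMonomials, LinearMap.comp_apply, LinearMap.mulRight_apply, X_pow_eq_monomial,
    monomial_mul, mul_one, powEval_monomial, LinearMap.zero_apply]
  exact Finset.prod_eq_zero (Finset.mem_univ x) (h _ (by simp))

lemma powEval_mul_prod_one_sub {ι : Type*} {M : ℕ} {x y : ι → κ}
    (h : ∀ i, ∀ m, M ≤ m → g (y i) m = 0) (s : Finset ι) (p : MvPolynomial κ ℚ) :
    powEval g (p * ∏ i ∈ s, (1 - (X (x i) * X (y i)) ^ M)) = powEval g p := by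
  classical
  induction s using Finset.induction_on with
  | empty => simp
  | insert i s hi ih =>
    rw [Finset.prod_insert hi]
    have : p * ((1 - (X (x i) * X (y i)) ^ M) * ∏ i ∈ s, (1 - (X (x i) * X (y i)) ^ M)) =
        p * ∏ i ∈ s, (1 - (X (x i) * X (y i)) ^ M) -
          p * X (x i) ^ M * (∏ i ∈ s, (1 - (X (x i) * X (y i)) ^ M)) * X (y i) ^ M := by
      ring
    rw [this, map_sub, ih, powEval_mul_pow_eq_zero g (h i), sub_zero]

lemma powEval_det [DecidableEq κ] (a : κ → ℕ) (c : κ → κ → ℕ) :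
    powEval g ((∏ x, X x ^ a x) * (Matrix.of fun x y => X x ^ c x y).det) =
      (Matrix.of fun x y => g x (a x + c x y)).det := by
  simp only [det_eq_sum_prod_row, Finset.mul_sum, map_sum, mul_smul_comm, map_zsmul, of_apply,
    ← Finset.prod_mul_distrib, ← pow_add, powEval_prod_pow]

lemma powEval_det_mul_det {ι ι' : Type*} [Fintype ι] [Fintype ι'] [DecidableEq ι] [DecidableEq ι']
    (g : ι ⊕ ι' → ℕ → R) (a : ι → ℕ) (c : ι → ι → ℕ) (b : ι' → ℕ) (d : ι' → ι' → ℕ) :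
    powEval g (((∏ i, X (Sum.inl i) ^ a i) * (Matrix.of fun i j => X (Sum.inl i) ^ c i j).det) *
        ((∏ i, X (Sum.inr i) ^ b i) * (Matrix.of fun i j => X (Sum.inr i) ^ d i j).det)) =
      (Matrix.of fun i j => g (Sum.inl i) (a i + c i j)).det *
        (Matrix.of fun i j => g (Sum.inr i) (b i + d i j)).det := by
  simp only [det_eq_sum_prod_row, Finset.mul_sum, mul_smul_comm, of_apply,
    ← Finset.prod_mul_distrib, ← pow_add, Finset.sum_mul, smul_mul_assoc, map_sum, map_zsmul]
  refine Finset.sum_congr rfl fun σ _ => congrArg _ (Finset.sum_congr rfl fun π _ => ?_)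
  have := powEval_prod_pow g (Sum.elim (fun i => a i + c i (π i)) fun i => b i + d i (σ i))
  rw [Fintype.prod_sum_type, Fintype.prod_sum_type] at this
  simp only [Sum.elim_inl, Sum.elim_inr] at this
  rw [this]

lemma powEval_mul_antisymm {ι : Type*} [Fintype ι] [DecidableEq ι]
    {τ : Equiv.Perm ι → Equiv.Perm κ} (h : ∀ σ x, g (τ σ x) = g x) {p : MvPolynomial κ ℚ}
    (hp : ∀ σ, rename (τ σ) p = (Equiv.Perm.sign σ : ℤ) • p) (q : MvPolynomial κ ℚ) :
    powEval g (p * ∑ σ, (Equiv.Perm.sign σ : ℤ) • rename (τ σ) q) =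
      (Fintype.card ι).factorial • powEval g (p * q) := by
  rw [Finset.mul_sum, map_sum]
  have : ∀ σ, powEval g (p * (Equiv.Perm.sign σ : ℤ) • rename (τ σ) q) = powEval g (p * q) := by
    intro σ
    rw [mul_smul_comm, ← smul_mul_assoc, ← hp, ← map_mul, powEval_rename g (h σ)]
  rw [Finset.sum_congr rfl fun σ _ => this σ, Finset.sum_const, Finset.card_univ,
    Fintype.card_perm]

end powEval

section antisymmetrization

variable {ℓ : ℕ}

/-- The first group of variables. -/
abbrev wVar (i : Fin ℓ) : MvPolynomial (Fin ℓ ⊕ Fin ℓ) ℚ := X (Sum.inl i)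

/-- The second group of variables. -/
abbrev uVar (i : Fin ℓ) : MvPolynomial (Fin ℓ ⊕ Fin ℓ) ℚ := X (Sum.inr i)

/-- Permuting the first group of variables. -/
abbrev permLeft (σ : Equiv.Perm (Fin ℓ)) : Equiv.Perm (Fin ℓ ⊕ Fin ℓ) := Equiv.sumCongr σ 1

/-- Permuting the second group of variables. -/
abbrev permRight (σ : Equiv.Perm (Fin ℓ)) : Equiv.Perm (Fin ℓ ⊕ Fin ℓ) := Equiv.sumCongr 1 σ

lemma rename_det_vandermonde {κ κ' : Type*} (f : κ → κ')
    (x : Fin ℓ → MvPolynomial κ ℚ) :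
    rename f (vandermonde x).det = (vandermonde fun i => rename f (x i)).det := by
  rw [AlgHom.map_det]
  congr 1
  ext i j
  simp [vandermonde]

lemma det_vandermonde_comp_perm {A : Type*} [CommRing A] (x : Fin ℓ → A)
    (σ : Equiv.Perm (Fin ℓ)) :
    (vandermonde fun i => x (σ i)).det = (Equiv.Perm.sign σ : ℤ) • (vandermonde x).det := by
  rw [zsmul_eq_mul, ← det_permute]
  rfl

lemma sum_rename_prod_erase : ∑ σ : Equiv.Perm (Fin ℓ), (Equiv.Perm.sign σ : ℤ) •
      rename (permLeft σ) (∏ j : Fin ℓ, ∏ i ∈ Finset.univ.erase j, (1 - wVar i * uVar j)) =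
    (vandermonde (wVar (ℓ := ℓ))).det * (vandermonde (uVar (ℓ := ℓ))).det := by
  rw [← det_prod_erase_one_sub_mul fun i j h => Sum.inl_injective (X_injective h), det_apply]
  refine Finset.sum_congr rfl fun σ _ => ?_
  congr 1
  simp only [map_prod, map_sub, map_one, map_mul, rename_X, of_apply]
  refine Finset.prod_congr rfl fun j _ => Finset.prod_equiv σ (fun i => by simp) fun i _ => ?_
  simp

/-- Summing `powEval` over a box of exponents, for a symmetric weight `p`. -/
lemma sum_powEval {R : Type*} [CommRing R] [Algebra ℚ R] (a b : ℕ → R) {M : ℕ}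
    (hM : ∀ m, M ≤ m → b m = 0) (p : MvPolynomial (Fin ℓ ⊕ Fin ℓ) ℚ)
    (hl : ∀ σ : Equiv.Perm (Fin ℓ), rename (permLeft σ) p = p)
    (hr : ∀ σ : Equiv.Perm (Fin ℓ), rename (permRight σ) p = p) :
    ∑ q ∈ Fintype.piFinset fun _ : Fin ℓ => Finset.range M,
      powEval (Sum.elim (fun _ : Fin ℓ => a) fun _ : Fin ℓ => b)
        (p * (∏ i, (wVar i * uVar i) ^ q i) * ((vandermonde wVar).det * (vandermonde uVar).det *
          ∏ i, ∏ j, (1 - wVar i * uVar j))) =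
    ℓ.factorial • powEval (Sum.elim (fun _ : Fin ℓ => a) fun _ : Fin ℓ => b)
        (p * ((vandermonde wVar).det * (vandermonde uVar).det) * (∏ i : Fin ℓ, wVar i ^ (i : ℕ)) *
          ∏ i : Fin ℓ, uVar i ^ (i : ℕ)) := by
  set g : Fin ℓ ⊕ Fin ℓ → ℕ → R := Sum.elim (fun _ : Fin ℓ => a) fun _ : Fin ℓ => b with hg
  set Vw : MvPolynomial (Fin ℓ ⊕ Fin ℓ) ℚ := (vandermonde wVar).det with hVw
  set Vu : MvPolynomial (Fin ℓ ⊕ Fin ℓ) ℚ := (vandermonde uVar).det with hVu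
  set A : MvPolynomial (Fin ℓ ⊕ Fin ℓ) ℚ :=
    ∏ j : Fin ℓ, ∏ i ∈ Finset.univ.erase j, (1 - wVar i * uVar j) with hA
  have hgl : ∀ (σ : Equiv.Perm (Fin ℓ)) x, g (permLeft σ x) = g x := by
    rintro σ (x | x) <;> simp [hg]
  have hgr : ∀ (σ : Equiv.Perm (Fin ℓ)) x, g (permRight σ x) = g x := by
    rintro σ (x | x) <;> simp [hg]
  have hVwl : ∀ σ : Equiv.Perm (Fin ℓ),
      rename (permLeft σ) Vw = (Equiv.Perm.sign σ : ℤ) • Vw := fun σ => by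
    rw [hVw, rename_det_vandermonde, ← det_vandermonde_comp_perm]
    simp
  have hVur : ∀ σ : Equiv.Perm (Fin ℓ),
      rename (permRight σ) Vu = (Equiv.Perm.sign σ : ℤ) • Vu := fun σ => by
    rw [hVu, rename_det_vandermonde, ← det_vandermonde_comp_perm]
    simp
  have hVul : ∀ σ : Equiv.Perm (Fin ℓ), rename (permLeft σ) Vu = Vu := fun σ => by
    rw [hVu, rename_det_vandermonde]
    simp
  have hVwr : ∀ σ : Equiv.Perm (Fin ℓ), rename (permRight σ) Vw = Vw := fun σ => by
    rw [hVw, rename_det_vandermonde]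
    simp
  have hsumw : ∑ σ : Equiv.Perm (Fin ℓ), (Equiv.Perm.sign σ : ℤ) •
      rename (permLeft σ) (∏ i : Fin ℓ, wVar i ^ (i : ℕ)) = Vw := by
    rw [hVw, det_apply]
    exact Finset.sum_congr rfl fun σ _ =>
      congrArg (fun y => (Equiv.Perm.sign σ : ℤ) • y) (by simp [vandermonde])
  have hsumu : ∑ σ : Equiv.Perm (Fin ℓ), (Equiv.Perm.sign σ : ℤ) •
      rename (permRight σ) (∏ i : Fin ℓ, uVar i ^ (i : ℕ)) = Vu := by
    rw [hVu, det_apply]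
    exact Finset.sum_congr rfl fun σ _ =>
      congrArg (fun y => (Equiv.Perm.sign σ : ℤ) • y) (by simp [vandermonde])
  have hgeom : ∑ q ∈ Fintype.piFinset fun _ : Fin ℓ => Finset.range M,
      powEval g (p * (∏ i, (wVar i * uVar i) ^ q i) * (Vw * Vu *
          ∏ i, ∏ j, (1 - wVar i * uVar j))) = powEval g (p * (Vw * Vu) * A) := by
    have e : ∏ i : Fin ℓ, ∏ j : Fin ℓ, (1 - wVar i * uVar j) =
        (∏ i : Fin ℓ, (1 - wVar i * uVar i)) * A := by
      rw [Finset.prod_comm, ← Finset.prod_mul_distrib]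
      exact Finset.prod_congr rfl fun j _ => (Finset.mul_prod_erase _ _ (Finset.mem_univ j)).symm
    rw [e, ← map_sum, ← powEval_mul_prod_one_sub g (x := Sum.inl) (y := Sum.inr)
      (fun _ => hM) Finset.univ (p * (Vw * Vu) * A)]
    have e' : ∏ i : Fin ℓ, (1 - (X (Sum.inl i) * X (Sum.inr i)) ^ M) =
        (∑ q ∈ Fintype.piFinset fun _ : Fin ℓ => Finset.range M,
          ∏ i, (wVar i * uVar i) ^ q i) * ∏ i : Fin ℓ, (1 - wVar i * uVar i) := by
      rw [← Finset.prod_univ_sum, ← Finset.prod_mul_distrib]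
      exact Finset.prod_congr rfl fun i _ => (geom_sum_mul_neg _ _).symm
    rw [e', ← Finset.sum_mul, ← Finset.mul_sum]
    congr 1
    ring
  have h1 := powEval_mul_antisymm g hgl (p := p * (Vw * Vu))
    (fun σ => by rw [map_mul, map_mul, hl, hVwl, hVul, smul_mul_assoc, mul_smul_comm]) A
  have h2 := powEval_mul_antisymm g hgl (p := p * (Vw * Vu) * Vu)
    (fun σ => by simp only [map_mul, hl, hVwl, hVul, smul_mul_assoc, mul_smul_comm])
    (∏ i : Fin ℓ, wVar i ^ (i : ℕ))
  have h3 := powEval_mul_antisymm g hgr (p := p * (Vw * Vu) * (∏ i : Fin ℓ, wVar i ^ (i : ℕ)))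
    (fun σ => by
      simp only [map_mul, hr, hVwr, hVur, smul_mul_assoc, mul_smul_comm, map_prod, map_pow,
        rename_X, Equiv.sumCongr_apply, Sum.map_inl, Equiv.Perm.one_apply])
    (∏ i : Fin ℓ, uVar i ^ (i : ℕ))
  rw [sum_rename_prod_erase, ← hVw, ← hVu] at h1
  rw [hsumw] at h2
  rw [hsumu] at h3
  rw [hgeom]
  simp only [Fintype.card_fin] at h1 h2 h3
  have h4 : ℓ.factorial • powEval g (p * (Vw * Vu) * A) = ℓ.factorial • ℓ.factorial •
      powEval g (p * (Vw * Vu) * (∏ i : Fin ℓ, wVar i ^ (i : ℕ)) *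
        ∏ i : Fin ℓ, uVar i ^ (i : ℕ)) := by
    rw [← h1, ← h3, mul_right_comm _ _ Vu, ← h2]
    congr 1
    ring
  have h5 : (ℓ.factorial : ℚ) ≠ 0 := by exact_mod_cast ℓ.factorial_ne_zero
  simp only [← Nat.cast_smul_eq_nsmul ℚ] at h4 ⊢
  exact (smul_right_injective R h5) h4

end antisymmetrization

section pairDet

variable {n k ℓ : ℕ}

/-- A signed Jacobi-Trudi determinant of size `2ℓ`, with `ℓ` rows raised by `B` and `ℓ` rows
lowered by `C`. -/
def pairDet (n k : ℕ) {ℓ : ℕ} (B C : Fin ℓ → ℤ) : MvPolynomial (Fin n) ℚ :=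
  (Equiv.Perm.sign (Fin.revPerm (n := ℓ)) : ℤ) •
    rowDet (hInt n) (fun y : Fin ℓ ⊕ Fin ℓ => (finSumFinEquiv y : ℕ))
      (Sum.elim (fun i => (k : ℤ) - ℓ + 1 + B i) fun i => (k : ℤ) - ℓ - C i)

lemma sign_zsmul_sign_zsmul {A ι : Type*} [AddCommGroup A] [Fintype ι] [DecidableEq ι]
    (σ : Equiv.Perm ι) (x : A) :
    (Equiv.Perm.sign σ : ℤ) • (Equiv.Perm.sign σ : ℤ) • x = x := by
  rw [smul_smul, Int.units_coe_mul_self, one_smul]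

/-- The functional sending monomials to products of complete homogeneous polynomials. -/
def hEval (n k ℓ : ℕ) : MvPolynomial (Fin ℓ ⊕ Fin ℓ) ℚ →ₗ[ℚ] MvPolynomial (Fin n) ℚ :=
  powEval (Sum.elim (fun _ m => hInt n ((k : ℤ) - ℓ - 1 + m))
    fun _ m => hInt n ((k : ℤ) + ℓ - 1 - m))

lemma hEval_mul_prod_one_sub (α β : Fin ℓ → ℕ) :
    hEval n k ℓ ((∏ i, wVar i ^ α i) * (∏ i, uVar i ^ β i) *
      ((vandermonde wVar).det * (vandermonde uVar).det * ∏ i, ∏ j, (1 - wVar i * uVar j))) =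
    pairDet n k (fun i => (α i : ℤ) - 2) (fun i => β i) := by
  rw [← sign_zsmul_sign_zsmul (Fin.revPerm (n := ℓ)) ((vandermonde wVar).det *
    (vandermonde uVar).det * ∏ i, ∏ j, (1 - wVar i * uVar j)), ← det_pow_append, mul_smul_comm,
    map_zsmul, pairDet]
  congr 1
  have := powEval_det (Sum.elim (fun _ m => hInt n ((k : ℤ) - ℓ - 1 + m))
    fun _ m => hInt n ((k : ℤ) + ℓ - 1 - m)) (Sum.elim α β)
    (fun x y : Fin ℓ ⊕ Fin ℓ => Sum.elim (fun _ => (finSumFinEquiv y : ℕ))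
      (fun _ => 2 * ℓ - 1 - (finSumFinEquiv y : ℕ)) x)
  rw [Fintype.prod_sum_type] at this
  simp only [Sum.elim_inl, Sum.elim_inr] at this
  rw [hEval, rowDet]
  refine Eq.trans (congrArg _ ?_) (this.trans (congrArg _ ?_))
  · congr 2
    ext1 x y
    rcases x with i | i <;> simp
  · ext1 x y
    have := (finSumFinEquiv y).is_lt
    rcases x with i | i
    · simp only [of_apply, Sum.elim_inl]
      congr 1
      push_cast
      ring
    · simp only [of_apply, Sum.elim_inr]
      congr 1
      omega

lemma hEval_mul_pow_mul_pow {a β : Fin ℓ → ℕ} (ha : ∀ i, a i ≤ 2) :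
    hEval n k ℓ ((∏ i, wVar i ^ (2 - a i)) * (∏ i, uVar i ^ β i) *
      ((vandermonde wVar).det * (vandermonde uVar).det) * (∏ i : Fin ℓ, wVar i ^ (i : ℕ)) *
          ∏ i : Fin ℓ, uVar i ^ (i : ℕ)) =
    rowDet (hInt n) Fin.val (fun i : Fin ℓ => (k : ℤ) - (i : ℕ) - a (Fin.rev i)) *
      rowDet (hInt n) Fin.val (fun i : Fin ℓ => (k : ℤ) - (i : ℕ) - β i) := by
  have h1 : rowDet (hInt n) Fin.val (fun i : Fin ℓ => (k : ℤ) - (i : ℕ) - a (Fin.rev i)) =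
      (Equiv.Perm.sign (Fin.revPerm (n := ℓ)) : ℤ) • (Matrix.of fun i j : Fin ℓ =>
        hInt n ((k : ℤ) - ℓ - 1 + ((2 - a i + (i : ℕ) + (j : ℕ) : ℕ) : ℤ))).det := by
    rw [rowDet, zsmul_eq_mul, ← det_permute]
    congr 1
    ext1 i j
    simp only [of_apply, submatrix_apply, Fin.revPerm_apply, id]
    congr 1
    have := ha (Fin.rev i)
    have := Fin.val_rev i
    have := i.is_lt
    omega
  have h2 : rowDet (hInt n) Fin.val (fun i : Fin ℓ => (k : ℤ) - (i : ℕ) - β i) =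
      (Equiv.Perm.sign (Fin.revPerm (n := ℓ)) : ℤ) • (Matrix.of fun i j : Fin ℓ =>
        hInt n ((k : ℤ) + ℓ - 1 - ((β i + (i : ℕ) + (j : ℕ) : ℕ) : ℤ))).det := by
    rw [rowDet, zsmul_eq_mul, ← det_permute']
    congr 1
    ext1 i j
    simp only [of_apply, submatrix_apply, Fin.revPerm_apply, id]
    congr 1
    have := Fin.val_rev j
    have := j.is_lt
    omega
  have h3 := powEval_det_mul_det (Sum.elim (fun _ m => hInt n ((k : ℤ) - ℓ - 1 + m))
    fun _ m => hInt n ((k : ℤ) + ℓ - 1 - m)) (fun i : Fin ℓ => 2 - a i + (i : ℕ))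
    (fun i j => (j : ℕ)) (fun i : Fin ℓ => β i + (i : ℕ)) (fun i j => (j : ℕ))
  rw [h1, h2, smul_mul_assoc, mul_smul_comm, sign_zsmul_sign_zsmul]
  simp only [Sum.elim_inl, Sum.elim_inr] at h3
  refine Eq.trans ?_ h3
  rw [hEval]
  congr 1
  simp only [pow_add, Finset.prod_mul_distrib, vandermonde]
  ring

end pairDet

section boxSums

variable {n k ℓ : ℕ}

lemma sum_hEval (p : MvPolynomial (Fin ℓ ⊕ Fin ℓ) ℚ)
    (hl : ∀ σ : Equiv.Perm (Fin ℓ), rename (permLeft σ) p = p)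
    (hr : ∀ σ : Equiv.Perm (Fin ℓ), rename (permRight σ) p = p) :
    ∑ q ∈ Fintype.piFinset fun _ : Fin ℓ => Finset.range (k + ℓ),
      hEval n k ℓ (p * (∏ i, (wVar i * uVar i) ^ q i) *
        ((vandermonde wVar).det * (vandermonde uVar).det * ∏ i, ∏ j, (1 - wVar i * uVar j))) =
    ℓ.factorial • hEval n k ℓ
        (p * ((vandermonde wVar).det * (vandermonde uVar).det) * (∏ i : Fin ℓ, wVar i ^ (i : ℕ)) *
          ∏ i : Fin ℓ, uVar i ^ (i : ℕ)) :=
  sum_powEval _ _ (fun m hm => hInt_of_neg n (by omega)) p hl hr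

/-- The monomial `∏ wᵢ ^ (2 - aᵢ)`. -/
def wMon (a : Fin ℓ → ℕ) : MvPolynomial (Fin ℓ ⊕ Fin ℓ) ℚ := ∏ i, wVar i ^ (2 - a i)

lemma rename_permLeft_wMon (σ : Equiv.Perm (Fin ℓ)) (a : Fin ℓ → ℕ) :
    rename (permLeft σ) (wMon a) = wMon (a ∘ σ.symm) := by
  simp only [wMon, map_prod, map_pow, rename_X]
  exact Finset.prod_equiv σ (by simp) fun i _ => by simp

lemma rename_permRight_wMon (σ : Equiv.Perm (Fin ℓ)) (a : Fin ℓ → ℕ) :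
    rename (permRight σ) (wMon a) = wMon a := by
  simp [wMon]

lemma single_comp_symm (σ : Equiv.Perm (Fin ℓ)) (i : Fin ℓ) :
    (Pi.single i 1 : Fin ℓ → ℕ) ∘ σ.symm = Pi.single (σ i) 1 := by
  ext x
  simp [Pi.single_apply, Equiv.symm_apply_eq]

lemma hEval_wMon (a q β : Fin ℓ → ℕ) (ha : ∀ i, a i ≤ 2) :
    hEval n k ℓ (wMon a * (∏ i, uVar i ^ β i) * (∏ i, (wVar i * uVar i) ^ q i) *
        ((vandermonde wVar).det * (vandermonde uVar).det * ∏ i, ∏ j, (1 - wVar i * uVar j))) =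
      pairDet n k (fun i => (q i : ℤ) - a i) (fun i => (q i : ℤ) + β i) := by
  have := hEval_mul_prod_one_sub (n := n) (k := k) (fun i : Fin ℓ => 2 - a i + q i)
    (fun i => β i + q i)
  rw [show (fun i => (q i : ℤ) - a i) = fun i : Fin ℓ => ((2 - a i + q i : ℕ) : ℤ) - 2 by
      ext i; have := ha i; omega,
    show (fun i => (q i : ℤ) + β i) = fun i : Fin ℓ => ((β i + q i : ℕ) : ℤ) by
      ext i; omega, ← this]
  congr 1
  simp only [wMon, mul_pow, pow_add, Finset.prod_mul_distrib]
  ring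

lemma single_le_one (i x : Fin ℓ) : (Pi.single i 1 : Fin ℓ → ℕ) x ≤ 1 := by
  rw [Pi.single_apply]
  split_ifs <;> simp

lemma natCast_single (i x : Fin ℓ) : (((Pi.single i 1 : Fin ℓ → ℕ) x : ℕ) : ℤ) =
    (Pi.single i 1 : Fin ℓ → ℤ) x := by
  simp [Pi.single_apply]

lemma single_rev (i x : Fin ℓ) : (Pi.single i 1 : Fin ℓ → ℤ) (Fin.rev x) =
    (Pi.single (Fin.rev i) 1 : Fin ℓ → ℤ) x := by
  simp only [Pi.single_apply, Fin.rev_eq_iff]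

lemma sum_pairDet_one (b : Fin ℓ → ℤ) (hb : b = fun i : Fin ℓ => (k : ℤ) - (i : ℕ)) :
    ∑ q ∈ Fintype.piFinset fun _ : Fin ℓ => Finset.range (k + ℓ), ∑ i, ∑ j,
      pairDet n k ((fun x => (q x : ℤ)) - Pi.single i 1) ((fun x => (q x : ℤ)) + Pi.single j 1) =
    ℓ.factorial • (∑ i, rowDet (hInt n) Fin.val (b - Pi.single i 1)) ^ 2 := by
  have h := sum_hEval (n := n) (k := k)
    ((∑ i : Fin ℓ, wMon (Pi.single i 1)) * ∑ j : Fin ℓ, ∏ x, uVar x ^ (Pi.single j 1 : Fin ℓ → ℕ) x)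
    (fun σ => by
      simp only [map_mul, map_sum, rename_permLeft_wMon, single_comp_symm]
      rw [Equiv.sum_comp σ fun i => wMon (Pi.single i 1)]
      simp)
    (fun σ => by
      simp only [map_mul, map_sum, rename_permRight_wMon]
      congr 1
      refine Fintype.sum_equiv σ _ _ fun i => ?_
      simp only [map_prod, map_pow, rename_X]
      refine Finset.prod_equiv σ (by simp) fun x _ => ?_
      simp [Pi.single_apply])
  rw [Finset.sum_mul_sum] at h
  simp only [Finset.sum_mul, map_sum] at h
  refine Eq.trans ?_ (h.trans ?_)
  · refine Finset.sum_congr rfl fun q _ => Finset.sum_congr rfl fun i _ =>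
      Finset.sum_congr rfl fun j _ => ?_
    rw [hEval_wMon _ _ _ fun x => (single_le_one i x).trans one_le_two]
    simp only [natCast_single]
    rfl
  · congr 1
    rw [sq, Finset.sum_mul_sum, ← Equiv.sum_comp Fin.revPerm]
    refine Finset.sum_congr rfl fun i _ => Finset.sum_congr rfl fun j _ => ?_
    rw [wMon, hEval_mul_pow_mul_pow fun x => (single_le_one _ x).trans one_le_two]
    simp only [natCast_single, single_rev, Fin.revPerm_apply, Fin.rev_rev, hb]
    rfl

lemma hEval_wMon_add_single (q : Fin ℓ → ℕ) (i j : Fin ℓ) :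
    hEval n k ℓ (wMon (Pi.single i 1 + Pi.single j 1) * (∏ i, (wVar i * uVar i) ^ q i) *
        ((vandermonde wVar).det * (vandermonde uVar).det * ∏ i, ∏ j, (1 - wVar i * uVar j))) =
      pairDet n k ((fun x => (q x : ℤ)) - Pi.single i 1 - Pi.single j 1) fun x => (q x : ℤ) := by
  have h := hEval_wMon (n := n) (k := k) (Pi.single i 1 + Pi.single j 1) q 0 fun x =>
    add_le_add (single_le_one i x) (single_le_one j x)
  simp only [Pi.zero_apply, pow_zero, Finset.prod_const_one, mul_one] at h
  rw [h]
  congr 1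
  ext x
  simp only [Pi.add_apply, Nat.cast_add, natCast_single, Pi.sub_apply]
  ring

lemma hEval_wMon_rev_add_single (b : Fin ℓ → ℤ) (hb : b = fun i : Fin ℓ => (k : ℤ) - (i : ℕ))
    (i j : Fin ℓ) :
    hEval n k ℓ (wMon (Pi.single (Fin.rev i) 1 + Pi.single (Fin.rev j) 1) *
      ((vandermonde wVar).det * (vandermonde uVar).det) * (∏ i : Fin ℓ, wVar i ^ (i : ℕ)) *
          ∏ i : Fin ℓ, uVar i ^ (i : ℕ)) =
      rowDet (hInt n) Fin.val b *
        rowDet (hInt n) Fin.val (b - Pi.single i 1 - Pi.single j 1) := by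
  have h := hEval_mul_pow_mul_pow (n := n) (k := k)
    (a := Pi.single (Fin.rev i) 1 + Pi.single (Fin.rev j) 1) (β := 0) fun x =>
    add_le_add (single_le_one _ x) (single_le_one _ x)
  simp only [Pi.zero_apply, pow_zero, Finset.prod_const_one, mul_one] at h
  rw [wMon, h, mul_comm, hb]
  congr 2
  · ext x
    simp
  · ext x
    simp only [Pi.add_apply, Nat.cast_add, natCast_single, single_rev, Fin.rev_rev, Pi.sub_apply]
    ring

lemma sum_pairDet_two (b : Fin ℓ → ℤ) (hb : b = fun i : Fin ℓ => (k : ℤ) - (i : ℕ)) :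
    ∑ q ∈ Fintype.piFinset fun _ : Fin ℓ => Finset.range (k + ℓ), ∑ i, ∑ j,
      pairDet n k ((fun x => (q x : ℤ)) - Pi.single i 1 - Pi.single j 1) (fun x => (q x : ℤ)) =
    ℓ.factorial • (rowDet (hInt n) Fin.val b *
      ∑ i, ∑ j, rowDet (hInt n) Fin.val (b - Pi.single i 1 - Pi.single j 1)) := by
  have h := sum_hEval (n := n) (k := k) (∑ i : Fin ℓ, ∑ j, wMon (Pi.single i 1 + Pi.single j 1))
    (fun σ => by
      simp only [map_sum, rename_permLeft_wMon, Pi.add_comp, single_comp_symm]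
      exact Fintype.sum_equiv σ _ _ fun i => Fintype.sum_equiv σ _ _ fun j => rfl)
    (fun σ => by simp only [map_sum, rename_permRight_wMon])
  simp only [Finset.sum_mul, map_sum, hEval_wMon_add_single] at h
  rw [h]
  congr 1
  rw [Finset.mul_sum]
  refine (Fintype.sum_equiv Fin.revPerm _ _ fun i => ?_).symm
  rw [Finset.mul_sum]
  exact Fintype.sum_equiv Fin.revPerm _ _ fun j => (hEval_wMon_rev_add_single b hb i j).symm

lemma sum_pairDet_diag (b : Fin ℓ → ℤ) (hb : b = fun i : Fin ℓ => (k : ℤ) - (i : ℕ)) :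
    ∑ q ∈ Fintype.piFinset fun _ : Fin ℓ => Finset.range (k + ℓ), ∑ i,
      pairDet n k ((fun x => (q x : ℤ)) - Pi.single i 1 - Pi.single i 1) (fun x => (q x : ℤ)) =
    ℓ.factorial • (rowDet (hInt n) Fin.val b *
      ∑ i, rowDet (hInt n) Fin.val (b - Pi.single i 1 - Pi.single i 1)) := by
  have h := sum_hEval (n := n) (k := k) (∑ i : Fin ℓ, wMon (Pi.single i 1 + Pi.single i 1))
    (fun σ => by
      simp only [map_sum, rename_permLeft_wMon, Pi.add_comp, single_comp_symm]
      exact Fintype.sum_equiv σ _ _ fun i => rfl)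
    (fun σ => by simp only [map_sum, rename_permRight_wMon])
  simp only [Finset.sum_mul, map_sum, hEval_wMon_add_single] at h
  rw [h]
  congr 1
  rw [Finset.mul_sum]
  exact (Fintype.sum_equiv Fin.revPerm _ _ fun i =>
    (hEval_wMon_rev_add_single b hb i i).symm).symm

end boxSums

section pairDetLemmas

variable {n k ℓ : ℕ} {B C : Fin ℓ → ℤ}

lemma pairDet_eq_zero_of_le {i : Fin ℓ} (hC : (k : ℤ) + ℓ ≤ C i) : pairDet n k B C = 0 := by
  rw [pairDet, rowDet_eq_zero_of_neg _ _ (fun m => hInt_of_neg n) (i := Sum.inr i), smul_zero]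
  intro y
  have := (finSumFinEquiv y).is_lt
  simp only [Sum.elim_inr]
  omega

lemma pairDet_eq_zero_of_right_eq {i j : Fin ℓ} (hij : i ≠ j) (hC : C i = C j) :
    pairDet n k B C = 0 := by
  rw [pairDet, rowDet_eq_zero_of_eq _ _ (i := Sum.inr i) (j := Sum.inr j) (by simpa using hij)
    (by simp [hC]), smul_zero]

lemma pairDet_eq_zero_of_add_eq {i j : Fin ℓ} (h : B i + C j + 1 = 0) : pairDet n k B C = 0 := by
  rw [pairDet, rowDet_eq_zero_of_eq _ _ (i := Sum.inl i) (j := Sum.inr j) (by simp)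
    (by simp only [Sum.elim_inl, Sum.elim_inr]; omega), smul_zero]

lemma pairDet_comp_left (σ : Equiv.Perm (Fin ℓ)) :
    pairDet n k (B ∘ σ) C = (Equiv.Perm.sign σ : ℤ) • pairDet n k B C := by
  rw [pairDet, pairDet, smul_comm]
  congr 1
  have := rowDet_comp_perm (hInt n) (fun y : Fin ℓ ⊕ Fin ℓ => (finSumFinEquiv y : ℕ))
    (Sum.elim (fun i => (k : ℤ) - ℓ + 1 + B i) fun i => (k : ℤ) - ℓ - C i)
    (Equiv.Perm.sumCongr σ 1)
  rw [Equiv.Perm.sign_sumCongr, map_one, mul_one] at this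
  rw [← this]
  congr 1
  ext x
  rcases x with x | x <;> simp

lemma pairDet_comp_right (σ : Equiv.Perm (Fin ℓ)) :
    pairDet n k B (C ∘ σ) = (Equiv.Perm.sign σ : ℤ) • pairDet n k B C := by
  rw [pairDet, pairDet, smul_comm]
  congr 1
  have := rowDet_comp_perm (hInt n) (fun y : Fin ℓ ⊕ Fin ℓ => (finSumFinEquiv y : ℕ))
    (Sum.elim (fun i => (k : ℤ) - ℓ + 1 + B i) fun i => (k : ℤ) - ℓ - C i)
    (Equiv.Perm.sumCongr 1 σ)
  rw [Equiv.Perm.sign_sumCongr, map_one, one_mul] at this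
  rw [← this]
  congr 1
  ext x
  rcases x with x | x <;> simp

lemma pairDet_comp (σ : Equiv.Perm (Fin ℓ)) :
    pairDet n k (B ∘ σ) (C ∘ σ) = pairDet n k B C := by
  rw [pairDet_comp_left, pairDet_comp_right, sign_zsmul_sign_zsmul]

lemma pairDet_comp_swap_left {i j : Fin ℓ} (hij : i ≠ j) :
    pairDet n k (B ∘ Equiv.swap i j) C = -pairDet n k B C := by
  rw [pairDet_comp_left, Equiv.Perm.sign_swap hij]
  simp

/-- Exchanging a raised row with a lowered row changes the sign. -/
lemma pairDet_exchange {B' C' : Fin ℓ → ℤ} (i : Fin ℓ) (hB : B' i = -1 - C i)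
    (hC : C' i = -1 - B i) (hB' : ∀ x ≠ i, B' x = B x) (hC' : ∀ x ≠ i, C' x = C x) :
    pairDet n k B' C' = -pairDet n k B C := by
  rw [pairDet, pairDet, ← smul_neg, ← rowDet_swap _ _ _
    (show (Sum.inl i : Fin ℓ ⊕ Fin ℓ) ≠ Sum.inr i by simp)]
  congr 2
  ext x
  rcases x with x | x
  · by_cases hx : x = i
    · subst hx
      simp only [Function.comp_apply, Equiv.swap_apply_left, Sum.elim_inl, Sum.elim_inr, hB]
      ring
    · rw [Function.comp_apply, Equiv.swap_apply_of_ne_of_ne (by simpa using hx) (by simp)]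
      simp [hB' x hx]
  · by_cases hx : x = i
    · subst hx
      simp only [Function.comp_apply, Equiv.swap_apply_right, Sum.elim_inl, Sum.elim_inr, hC]
      ring
    · rw [Function.comp_apply, Equiv.swap_apply_of_ne_of_ne (by simp) (by simpa using hx)]
      simp [hC' x hx]

lemma SchurPositive.pairDet (hB : Monotone B) (hC : Monotone C)
    (h : ∀ i j, 0 ≤ B i + C j + 1) : SchurPositive n (pairDet n k B C) := by
  have hrev : _root_.pairDet n k B C = _root_.rowDet (hInt n) Fin.val
      (Fin.append (fun i => (k : ℤ) - ℓ + 1 + B (Fin.rev i)) fun i => (k : ℤ) - ℓ - C i) := by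
    rw [← sign_zsmul_sign_zsmul Fin.revPerm (_root_.pairDet n k B C), ← pairDet_comp_left,
      _root_.pairDet, sign_zsmul_sign_zsmul, _root_.rowDet, _root_.rowDet,
      ← det_submatrix_equiv_self finSumFinEquiv]
    congr 1
    ext1 x y
    rcases x with x | x <;> simp [-Fin.natAdd_eq_addNat]
  rw [hrev]
  refine SchurPositive.rowDet fun x y hxy => ?_
  induction x using Fin.addCases with
  | left x =>
    induction y using Fin.addCases with
    | left y =>
      have := hB (Fin.rev_le_rev.2 ((Fin.strictMono_castAdd _).le_iff_le.1 hxy))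
      simp only [Fin.append_left]
      omega
    | right y =>
      have := h (Fin.rev x) y
      simp only [Fin.append_left, Fin.append_right]
      omega
  | right x =>
    induction y using Fin.addCases with
    | left y =>
      rw [Fin.le_def] at hxy
      have := y.is_lt
      simp at hxy
      omega
    | right y =>
      have := hC ((Fin.natAdd_le_natAdd_iff _).1 hxy)
      simp only [Fin.append_right]
      omega

end pairDetLemmas

section shift

lemma sum_piFinset_range_add_single {M : Type*} [AddCommMonoid M] {ℓ N : ℕ}
    (H : (Fin ℓ → ℕ) → M) (j : Fin ℓ) (hH : ∀ q, q j = N → H q = 0) :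
    ∑ q ∈ Fintype.piFinset fun _ : Fin ℓ => range N, H (q + Pi.single j 1) =
      ∑ q ∈ Fintype.piFinset fun _ : Fin ℓ => range N, if q j = 0 then 0 else H q := by
  refine Finset.sum_bij_ne_zero (fun q _ _ => q + Pi.single j 1) ?_ ?_ ?_ ?_
  · intro q hq h
    simp only [Fintype.mem_piFinset, mem_range, Pi.add_apply] at hq ⊢
    intro x
    by_cases hx : x = j
    · subst hx
      have h1 := mt (hH (q + Pi.single x 1)) h
      simp at h1 ⊢
      have := hq x
      omega
    · simpa [hx] using hq x
  · intro q _ _ q' _ _ h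
    exact add_right_cancel h
  · intro q hq h
    have hj : q j ≠ 0 := fun h0 => h (if_pos h0)
    rw [if_neg hj] at h
    have hq' : q - Pi.single j 1 + Pi.single j 1 = q := by
      ext x
      by_cases hx : x = j
      · subst hx
        simp
        omega
      · simp [hx]
    refine ⟨q - Pi.single j 1, ?_, by rwa [hq'], hq'⟩
    simp only [Fintype.mem_piFinset, mem_range, Pi.sub_apply] at hq ⊢
    exact fun x => (Nat.sub_le _ _).trans_lt (hq x)
  · intro q _ _
    simp

end shift

section boxTerm

variable {n k ℓ : ℕ}

/-- The signed determinant attached to a box point `q`, with two raised rows lowered by one. -/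
def boxDet (n k : ℕ) {ℓ : ℕ} (q : Fin ℓ → ℕ) (i j : Fin ℓ) : MvPolynomial (Fin n) ℚ :=
  pairDet n k ((fun x => (q x : ℤ)) - Pi.single i 1 - Pi.single j 1) fun x => (q x : ℤ)

/-- The total contribution of a box point `q`. -/
def boxTerm (n k : ℕ) {ℓ : ℕ} (c : ℚ) (q : Fin ℓ → ℕ) : MvPolynomial (Fin n) ℚ :=
  c ^ 2 • (∑ i, ∑ j, if q j = 0 then 0 else boxDet n k q i j) -
    (c / 2) • (c • (∑ i, ∑ j, boxDet n k q i j) - ∑ i, boxDet n k q i i)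

lemma boxDet_comm (q : Fin ℓ → ℕ) (i j : Fin ℓ) : boxDet n k q i j = boxDet n k q j i := by
  rw [boxDet, boxDet, sub_right_comm]

lemma boxDet_eq_zero_of_eq {q : Fin ℓ → ℕ} {x y : Fin ℓ} (hxy : x ≠ y) (hq : q x = q y)
    (i j : Fin ℓ) : boxDet n k q i j = 0 :=
  pairDet_eq_zero_of_right_eq hxy (by simp [hq])

lemma boxDet_eq_zero_of_ne {q : Fin ℓ → ℕ} {i j : Fin ℓ} (hij : i ≠ j) (hq : q j = 0) :
    boxDet n k q i j = 0 :=
  pairDet_eq_zero_of_add_eq (i := j) (j := j) (by simp [hq, hij.symm])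

lemma boxDet_comp (q : Fin ℓ → ℕ) (σ : Equiv.Perm (Fin ℓ)) (i j : Fin ℓ) :
    boxDet n k (q ∘ σ) i j = boxDet n k q (σ i) (σ j) := by
  rw [boxDet, boxDet, ← pairDet_comp (C := fun x => (q x : ℤ)) σ]
  congr 1
  ext x
  simp [Pi.single_apply]

lemma sum_sum_comp_perm {ι M : Type*} [Fintype ι] [AddCommMonoid M] (F : ι → ι → M)
    (σ : Equiv.Perm ι) : ∑ i, ∑ j, F (σ i) (σ j) = ∑ i, ∑ j, F i j := by
  rw [← Equiv.sum_comp σ fun i => ∑ j, F i j]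
  exact Finset.sum_congr rfl fun i _ => Equiv.sum_comp σ (F (σ i))

lemma boxTerm_comp (c : ℚ) (q : Fin ℓ → ℕ) (σ : Equiv.Perm (Fin ℓ)) :
    boxTerm n k c (q ∘ σ) = boxTerm n k c q := by
  simp only [boxTerm, boxDet_comp, Function.comp_apply]
  rw [sum_sum_comp_perm (fun i j => if q j = 0 then 0 else boxDet n k q i j) σ,
    sum_sum_comp_perm (boxDet n k q) σ, Equiv.sum_comp σ fun i => boxDet n k q i i]

lemma schurPositive_boxDet_of_ne {q : Fin ℓ → ℕ} (hq : StrictMono q) {i j : Fin ℓ} (hij : i ≠ j) :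
    SchurPositive n (boxDet n k q i j) := by
  refine SchurPositive.pairDet (fun x y hxy => ?_) (fun x y hxy => ?_) fun x y => ?_
  · rcases hxy.eq_or_lt with rfl | hlt
    · exact le_rfl
    · have := hq hlt
      simp only [Pi.sub_apply, Pi.single_apply]
      split_ifs <;> omega
  · exact_mod_cast hq.monotone hxy
  · simp only [Pi.sub_apply, Pi.single_apply]
    split_ifs <;> omega

lemma schurPositive_boxDet_self {q : Fin ℓ → ℕ} (hq : StrictMono q) {i : Fin ℓ} (hi : q i ≠ 0)
    (hgap : ∀ x < i, q x + 2 ≤ q i) : SchurPositive n (boxDet n k q i i) := by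
  refine SchurPositive.pairDet (fun x y hxy => ?_) (fun x y hxy => ?_) fun x y => ?_
  · rcases hxy.eq_or_lt with rfl | hlt
    · exact le_rfl
    · have := hq hlt
      have := hgap x
      simp only [Pi.sub_apply, Pi.single_apply]
      split_ifs with h1 h2 h2
      · omega
      · omega
      · subst h2
        have := hgap x hlt
        omega
      · omega
  · exact_mod_cast hq.monotone hxy
  · simp only [Pi.sub_apply, Pi.single_apply]
    split_ifs with h
    · subst h
      omega
    · omega

lemma schurPositive_neg_boxDet_self {q : Fin ℓ → ℕ} (hq : StrictMono q) {i : Fin ℓ}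
    (hi : q i = 0) : SchurPositive n (-boxDet n k q i i) := by
  rw [boxDet, ← pairDet_exchange (B' := (fun x => (q x : ℤ)) - Pi.single i 1)
    (C' := (fun x => (q x : ℤ)) + Pi.single i 1) i (by simp [hi]) (by simp [hi])
    (fun x hx => by simp [hx]) (fun x hx => by simp [hx])]
  refine SchurPositive.pairDet (fun x y hxy => ?_) (fun x y hxy => ?_) fun x y => ?_
  · rcases hxy.eq_or_lt with rfl | hlt
    · exact le_rfl
    · have := hq hlt
      simp only [Pi.sub_apply, Pi.single_apply]
      split_ifs <;> omega
  · rcases hxy.eq_or_lt with rfl | hlt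
    · exact le_rfl
    · have := hq hlt
      simp only [Pi.add_apply, Pi.single_apply]
      split_ifs <;> omega
  · simp only [Pi.sub_apply, Pi.add_apply, Pi.single_apply]
    split_ifs <;> omega

/-- Equal raised rows after lowering make two terms cancel. -/
lemma boxDet_self_eq_neg {q : Fin ℓ → ℕ} {i x : Fin ℓ} (hx : q i = q x + 1) :
    boxDet n k q i i = -boxDet n k q i x := by
  have hne : x ≠ i := by
    rintro rfl
    omega
  rw [boxDet, boxDet, ← pairDet_comp_swap_left hne]
  congr 1
  ext y
  simp only [Function.comp_apply, Pi.sub_apply, Pi.single_apply]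
  by_cases hyx : y = x
  · subst hyx
    simp [hne, hne.symm, hx]
  · by_cases hyi : y = i
    · subst hyi
      simp [hne, hx]
    · rw [Equiv.swap_apply_of_ne_of_ne hyx hyi]
      simp [hyx, hyi]

lemma schurPositive_boxDet_add_sum {q : Fin ℓ → ℕ} (hq : StrictMono q) (i : Fin ℓ) :
    SchurPositive n
      ((if q i = 0 then 0 else boxDet n k q i i) + ∑ j ∈ Iio i, boxDet n k q i j) := by
  have hpos (s : Finset (Fin ℓ)) (hs : ∀ j ∈ s, j < i) :
      SchurPositive n (∑ j ∈ s, boxDet n k q i j) :=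
    SchurPositive.sum fun j hj => schurPositive_boxDet_of_ne hq (hs j hj).ne'
  by_cases hi : q i = 0
  · rw [if_pos hi, zero_add]
    exact hpos _ fun j hj => mem_Iio.1 hj
  rw [if_neg hi]
  by_cases hgap : ∀ x < i, q x + 2 ≤ q i
  · exact (schurPositive_boxDet_self hq hi hgap).add (hpos _ fun j hj => mem_Iio.1 hj)
  · push Not at hgap
    obtain ⟨x, hxi, hx⟩ := hgap
    have := hq hxi
    rw [boxDet_self_eq_neg (x := x) (by omega), ← Finset.add_sum_erase _ _ (mem_Iio.2 hxi),
      neg_add_cancel_left]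
    exact hpos _ fun j hj => mem_Iio.1 (mem_of_mem_erase hj)

lemma sum_sum_eq_two_nsmul_add {M : Type*} [AddCommMonoid M] (T : Fin ℓ → Fin ℓ → M)
    (hT : ∀ i j, T i j = T j i) :
    ∑ i, ∑ j, T i j = 2 • (∑ i, ∑ j ∈ Iio i, T i j) + ∑ i, T i i := by
  have h (i : Fin ℓ) : ∑ j, T i j = ∑ j ∈ Iio i, T i j + ∑ j ∈ Ioi i, T i j + T i i := by
    rw [← Finset.sum_union, ← Finset.sum_singleton (T i) i, ← Finset.sum_union]
    · congr 1
      ext x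
      simpa using lt_or_ge x i
    · simp
    · exact Finset.disjoint_left.2 fun x hx hx' => (mem_Iio.1 hx).not_gt (mem_Ioi.1 hx')
  have h' : ∑ i, ∑ j ∈ Ioi i, T i j = ∑ i, ∑ j ∈ Iio i, T i j := by
    rw [Finset.sum_comm' (t' := univ) (s' := Iio) (by simp)]
    exact Finset.sum_congr rfl fun i _ => Finset.sum_congr rfl fun j _ => hT _ _
  simp only [h, Finset.sum_add_distrib, h', two_nsmul]

lemma schurPositive_boxTerm_of_strictMono {c : ℚ} (hc : 1 ≤ c) {q : Fin ℓ → ℕ}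
    (hq : StrictMono q) : SchurPositive n (boxTerm n k c q) := by
  set E := ∑ i, ∑ j ∈ Iio i, boxDet n k q i j with hE
  set Z := ∑ i, if q i = 0 then boxDet n k q i i else 0 with hZ
  set D := ∑ i, if q i = 0 then 0 else boxDet n k q i i with hD
  have hdiag : ∑ i, boxDet n k q i i = Z + D := by
    rw [hZ, hD, ← Finset.sum_add_distrib]
    refine Finset.sum_congr rfl fun i _ => ?_
    split_ifs <;> simp
  have hall : ∑ i, ∑ j, boxDet n k q i j = 2 • E + (Z + D) := by
    rw [sum_sum_eq_two_nsmul_add _ (boxDet_comm q), hdiag]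
  have hdrop : (∑ i, ∑ j, if q j = 0 then 0 else boxDet n k q i j) = 2 • E + D := by
    have hne {i j : Fin ℓ} (hij : i ≠ j) :
        (if q j = 0 then 0 else boxDet n k q i j) = boxDet n k q i j :=
      ite_eq_right_iff.2 fun h => (boxDet_eq_zero_of_ne hij h).symm
    rw [sum_sum_eq_two_nsmul_add]
    · congr 2
      exact Finset.sum_congr rfl fun i _ => Finset.sum_congr rfl fun j hj =>
        hne (mem_Iio.1 hj).ne'
    · intro i j
      by_cases hij : i = j
      · rw [hij]
      · rw [hne hij, hne (Ne.symm hij), boxDet_comm]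
  have hEZ : SchurPositive n (E + -Z) := by
    refine (SchurPositive.sum fun i _ => SchurPositive.sum fun j hj =>
      schurPositive_boxDet_of_ne hq (mem_Iio.1 hj).ne').add ?_
    rw [hZ, ← Finset.sum_neg_distrib]
    refine SchurPositive.sum fun i _ => ?_
    split_ifs with h
    · exact schurPositive_neg_boxDet_self hq h
    · rw [neg_zero]
      exact SchurPositive.zero
  have hED : SchurPositive n (D + E) := by
    rw [hD, hE, ← Finset.sum_add_distrib]
    exact SchurPositive.sum fun i _ => schurPositive_boxDet_add_sum hq i
  have : boxTerm n k c q = (c * (c - 1) / 2) • (E + -Z) + (c * (c + 1) / 2) • (D + E) := by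
    rw [boxTerm, hdiag, hall, hdrop]
    module
  rw [this]
  exact (hEZ.smul (by nlinarith)).add (hED.smul (by positivity))

lemma schurPositive_boxTerm {c : ℚ} (hc : 1 ≤ c) (q : Fin ℓ → ℕ) :
    SchurPositive n (boxTerm n k c q) := by
  by_cases hinj : Function.Injective q
  · rw [← boxTerm_comp c q (Tuple.sort q)]
    exact schurPositive_boxTerm_of_strictMono hc
      ((Tuple.monotone_sort q).strictMono_of_injective (hinj.comp (Tuple.sort q).injective))
  · obtain ⟨x, y, hq, hxy⟩ : ∃ x y, q x = q y ∧ x ≠ y := by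
      simpa [Function.Injective] using hinj
    have h (i j : Fin ℓ) : boxDet n k q i j = 0 := boxDet_eq_zero_of_eq hxy hq i j
    simpa [boxTerm, h] using SchurPositive.zero

lemma sum_pairDet_shift :
    ∑ q ∈ Fintype.piFinset fun _ : Fin ℓ => Finset.range (k + ℓ), ∑ i, ∑ j,
      pairDet n k ((fun x => (q x : ℤ)) - Pi.single i 1) ((fun x => (q x : ℤ)) + Pi.single j 1) =
    ∑ q ∈ Fintype.piFinset fun _ : Fin ℓ => Finset.range (k + ℓ), ∑ i, ∑ j,
      if q j = 0 then 0 else boxDet n k q i j := by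
  rw [Finset.sum_comm, Finset.sum_comm (s := Fintype.piFinset _)]
  refine Finset.sum_congr rfl fun i _ => ?_
  rw [Finset.sum_comm, Finset.sum_comm (s := Fintype.piFinset _)]
  refine Finset.sum_congr rfl fun j _ => ?_
  rw [← sum_piFinset_range_add_single (fun q => boxDet n k q i j) j
    fun q hq => pairDet_eq_zero_of_le (i := j) (by simp [hq])]
  refine Finset.sum_congr rfl fun q _ => ?_
  rw [boxDet]
  have h : (fun x => ((q + Pi.single j 1 : Fin ℓ → ℕ) x : ℤ)) =
      (fun x => (q x : ℤ)) + Pi.single j 1 := by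
    ext x
    simp only [Pi.add_apply, Nat.cast_add, natCast_single]
  rw [h, sub_right_comm, add_sub_cancel_right]

end boxTerm

lemma sum_boxTerm (k ℓ n : ℕ) (hk : 0 < k) (hℓ : 0 < ℓ) (c : ℚ) (hc : c = n + k - ℓ) :
    (∑ q ∈ Fintype.piFinset fun _ : Fin ℓ => Finset.range (k + ℓ), boxTerm n k c q) =
      ℓ.factorial • ((derived n 1 (schur n fun i => if i < ℓ then k else 0)) ^ 2 -
        schur n (fun i => if i < ℓ then k else 0) *
          derived n 2 (schur n fun i => if i < ℓ then k else 0)) := by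
  have h1 := sum_pairDet_one (n := n) (k := k) (ℓ := ℓ) _ rfl
  have h2 := sum_pairDet_two (n := n) (k := k) (ℓ := ℓ) _ rfl
  have h3 := sum_pairDet_diag (n := n) (k := k) (ℓ := ℓ) _ rfl
  rw [sum_pairDet_shift] at h1
  rw [derived_rectangle k ℓ n hk hℓ c hc _ rfl]
  simp only [boxTerm, Finset.sum_sub_distrib, ← Finset.smul_sum]
  rw [h1]
  simp only [boxDet]
  rw [h2, h3, mul_sub, mul_smul_comm]
  module

end

/-- for a rectangular partition `λ = (k^ℓ)` and `n ≥ ℓ` variables,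
`(s_λ^{(1)})^2 - s_λ * s_λ^{(2)}` is Schur positive. -/
theorem rectangle_schur_positive (k ℓ n : ℕ) (hk : 0 < k) (hℓ : 0 < ℓ) (hn : ℓ ≤ n) :
    SchurPositive n
      ((derived n 1 (schur n fun i => if i < ℓ then k else 0)) ^ 2 -
        schur n (fun i => if i < ℓ then k else 0) *
          derived n 2 (schur n fun i => if i < ℓ then k else 0)) := by
  have hc : (1 : ℚ) ≤ n + k - ℓ := by
    have h1 : (1 : ℚ) ≤ k := by exact_mod_cast hk
    have h2 : (ℓ : ℚ) ≤ n := by exact_mod_cast hn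
    linarith
  have h := (SchurPositive.sum (s := Fintype.piFinset fun _ : Fin ℓ => Finset.range (k + ℓ))
    fun q _ => schurPositive_boxTerm (n := n) (k := k) hc q).smul
    (a := (ℓ.factorial : ℚ)⁻¹) (by positivity)
  rwa [sum_boxTerm k ℓ n hk hℓ _ rfl, ← Nat.cast_smul_eq_nsmul ℚ,
    inv_smul_smul₀ (by exact_mod_cast ℓ.factorial_ne_zero)] at h

end
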